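/- Let λ₀ ∈ ℂⁿ have all entries nonzero, let A ∈ ℂ^{n×m}, let s ≥ 1, N ≥ 2, and let X₀ ∈ ℂ^{m×N} whose row support J₀ = {i : the i-th row of X₀ is nonzero} satisfies |J₀| ≤ s. Suppose that every row of A·X₀ is nonzero, and that for every J ⊆ {1,…,m} with J₀ ⊆ J and |J| ≤ 2s, the matrix M(A^{(:,J)}, X₀^{(J,:)}) ∈ ℂ^{(1+n(N−1))×|J|N} has full column rank |J|·N. Then (λ₀, X₀) is identifiable up to scaling with constraint set Ω_s = {X ∈ ℂ^{m×N} : X has at most s nonzero rows}: every (λ₁, X₁) ∈ ℂⁿ × Ω_s with diag(λ₁)·A·X₁ = diag(λ₀)·A·X₀ satisfies λ₁ = σ⁻¹·λ₀ and X₁ = σ·X₀ for some nonzero σ ∈ ℂ. -/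

import Mathlib

open MeasureTheory Matrix

noncomputable section

/-- The `(N-1) × N` matrix `B(a,X)`: for `j = 0,…,N-2` (0-indexed), entry `(j,0)` is
`-(a · X^{(:,j+1)})`, entry `(j,j+1)` is `a · X^{(:,0)}`, all other entries zero. -/
def Bmat {m N : ℕ} (a : Fin m → ℂ) (X : Matrix (Fin m) (Fin N) ℂ) :
    Matrix (Fin (N - 1)) (Fin N) ℂ :=
  Matrix.of fun j k =>
    if (k : ℕ) = 0 then
      -(a ⬝ᵥ fun i => X i ⟨(j : ℕ) + 1, by have := j.isLt; omega⟩)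
    else if (k : ℕ) = (j : ℕ) + 1 then
      a ⬝ᵥ fun i => X i ⟨0, by have := j.isLt; omega⟩
    else 0

/-- Column-wise vectorization of `X`, indexed by (column, row). -/
def vecM {m N : ℕ} (X : Matrix (Fin m) (Fin N) ℂ) : Fin N × Fin m → ℂ :=
  fun p => X p.2 p.1

/-- `D(a,X) = B(a,X) ⊗ a`, an `(N-1) × mN` matrix, columns indexed compatibly with `vecM`. -/
def Dsmall {m N : ℕ} (a : Fin m → ℂ) (X : Matrix (Fin m) (Fin N) ℂ) :
    Matrix (Fin (N - 1)) (Fin N × Fin m) ℂ :=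
  Matrix.of fun j p => Bmat a X j p.1 * a p.2

/-- `D(A,X)`: vertical stack of `D(A^{(k,:)},X)` over the rows `k` of `A`. -/
def Dbig {n m N : ℕ} (A : Matrix (Fin n) (Fin m) ℂ) (X : Matrix (Fin m) (Fin N) ℂ) :
    Matrix (Fin n × Fin (N - 1)) (Fin N × Fin m) ℂ :=
  Matrix.of fun q p => Dsmall (A q.1) X q.2 p

/-- `M(A,X)`: the row `vec(X)^*` stacked on top of `D(A,X)`. -/
def Mmat {n m N : ℕ} (A : Matrix (Fin n) (Fin m) ℂ) (X : Matrix (Fin m) (Fin N) ℂ) :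
    Matrix (Unit ⊕ Fin n × Fin (N - 1)) (Fin N × Fin m) ℂ :=
  Matrix.of fun q p =>
    match q with
    | Sum.inl _ => star (vecM X p)
    | Sum.inr r => Dbig A X r p

/-- `X` has at most `s` nonzero rows. -/
def JointSparse {m N : ℕ} (s : ℕ) (X : Matrix (Fin m) (Fin N) ℂ) : Prop :=
  {i : Fin m | X i ≠ 0}.ncard ≤ s

/-- The column submatrix of `A` with columns indexed by `J` in increasing order. -/
def colSub {n m : ℕ} (A : Matrix (Fin n) (Fin m) ℂ) (J : Finset (Fin m)) {l : ℕ}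
    (h : J.card = l) : Matrix (Fin n) (Fin l) ℂ :=
  A.submatrix id fun j => ((J.orderIsoOfFin h j : Fin m))

/-- The row submatrix of `X` with rows indexed by `J` in increasing order. -/
def rowSub {m N : ℕ} (X : Matrix (Fin m) (Fin N) ℂ) (J : Finset (Fin m)) {l : ℕ}
    (h : J.card = l) : Matrix (Fin l) (Fin N) ℂ :=
  X.submatrix (fun i => ((J.orderIsoOfFin h i : Fin m))) id

theorem Bmat_mulVec {m N : ℕ} (a : Fin m → ℂ) (X : Matrix (Fin m) (Fin (N + 1)) ℂ)
    (v : Fin (N + 1) → ℂ) (j : Fin N) :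
    ∑ c, Bmat a X j c * v c =
      (a ⬝ᵥ fun i => X i 0) * v j.succ - (a ⬝ᵥ fun i => X i j.succ) * v 0 := by
  rw [Fin.sum_univ_succ, Finset.sum_eq_single j]
  · simp only [Bmat, Matrix.of_apply, Fin.val_zero, if_true, Fin.val_succ, Nat.succ_ne_zero,
      if_false]
    change -(a ⬝ᵥ fun i => X i j.succ) * v 0 + (a ⬝ᵥ fun i => X i 0) * v j.succ = _
    ring
  · intro b _ hb
    have : (b : ℕ) ≠ j := fun h => hb (Fin.ext h)
    simp [Bmat, this]
  · simp

theorem Mmat_mulVec_inr {n m N : ℕ} (A : Matrix (Fin n) (Fin m) ℂ)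
    (X Y : Matrix (Fin m) (Fin (N + 1)) ℂ) (k : Fin n) (j : Fin N) :
    (Mmat A X *ᵥ vecM Y) (Sum.inr (k, j)) =
      (A * X) k 0 * (A * Y) k j.succ - (A * X) k j.succ * (A * Y) k 0 := by
  have h := Bmat_mulVec (A k) X (fun c => (A * Y) k c) j
  simp only [Matrix.mul_apply, dotProduct] at h ⊢
  rw [← h]
  simp only [Mmat, Matrix.mulVec, dotProduct, Matrix.of_apply, Dbig, Dsmall, vecM,
    Fintype.sum_prod_type, Finset.mul_sum, mul_assoc]

theorem Mmat_mulVec_inl {n m N : ℕ} (A : Matrix (Fin n) (Fin m) ℂ)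
    (X Y : Matrix (Fin m) (Fin N) ℂ) (u : Unit) :
    (Mmat A X *ᵥ vecM Y) (Sum.inl u) = star (vecM X) ⬝ᵥ vecM Y :=
  rfl

theorem vecM_injective {m N : ℕ} :
    Function.Injective (vecM : Matrix (Fin m) (Fin N) ℂ → Fin N × Fin m → ℂ) :=
  fun _ _ h => Matrix.ext fun i c => congrFun h (c, i)

theorem vecM_smul {m N : ℕ} (c : ℂ) (X : Matrix (Fin m) (Fin N) ℂ) :
    vecM (c • X) = c • vecM X :=
  rfl

theorem mulVec_injective_of_rank_eq_card {ι κ : Type*} [Fintype ι] [Fintype κ]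
    (M : Matrix ι κ ℂ) (h : M.rank = Fintype.card κ) : Function.Injective M.mulVec := by
  classical
  have hk := M.mulVecLin.finrank_range_add_finrank_ker
  rw [Module.finrank_fintype_fun_eq_card, ← h] at hk
  have h0 : Module.finrank ℂ (LinearMap.ker M.mulVecLin) = 0 := by
    unfold Matrix.rank at hk
    omega
  exact LinearMap.ker_eq_bot.mp (Submodule.finrank_eq_zero.mp h0)

open scoped ComplexOrder in
/-- If `M(A,X)` has trivial kernel and each row of `A·Y` is parallel to that of `A·X`, then `Y` is
a multiple of `X`. -/
theorem eq_smul_of_Mmat_injective {n m N : ℕ} (A : Matrix (Fin n) (Fin m) ℂ)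
    (X Y : Matrix (Fin m) (Fin N) ℂ) (hX : X ≠ 0)
    (hM : Function.Injective (Mmat A X).mulVec)
    (hpar : ∀ k c d, (A * X) k c * (A * Y) k d = (A * X) k d * (A * Y) k c) :
    ∃ σ : ℂ, Y = σ • X := by
  have hv : star (vecM X) ⬝ᵥ vecM X ≠ 0 := fun h =>
    hX (vecM_injective (dotProduct_star_self_eq_zero.mp h))
  refine ⟨(star (vecM X) ⬝ᵥ vecM Y) / (star (vecM X) ⬝ᵥ vecM X), vecM_injective (hM ?_)⟩
  ext q
  rcases q with u | ⟨k, j⟩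
  · rw [Mmat_mulVec_inl, Mmat_mulVec_inl, vecM_smul, dotProduct_smul, smul_eq_mul, div_mul_cancel₀ _ hv]
  · cases N with
    | zero => exact j.elim0
    | succ N =>
      refine (Mmat_mulVec_inr A X Y k j).trans (Eq.trans ?_ (Mmat_mulVec_inr A X _ k j).symm)
      rw [hpar, Matrix.mul_smul]
      simp only [Matrix.smul_apply, smul_eq_mul]
      ring

theorem colSub_mul_rowSub {n m N : ℕ} (A : Matrix (Fin n) (Fin m) ℂ)
    (Y : Matrix (Fin m) (Fin N) ℂ) (J : Finset (Fin m)) (hJ : ∀ i, Y i ≠ 0 → i ∈ J) :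
    colSub A J rfl * rowSub Y J rfl = A * Y := by
  ext k c
  simp only [Matrix.mul_apply, colSub, rowSub, Matrix.submatrix_apply, id]
  refine ((J.orderIsoOfFin rfl).toEquiv.sum_comp (fun x : J => A k x * Y x c)).trans ?_
  rw [Finset.sum_coe_sort J (fun i => A k i * Y i c)]
  refine Finset.sum_subset (Finset.subset_univ _) fun i _ hi => ?_
  have : Y i = 0 := by_contra fun h => hi (hJ i h)
  simp [this]

theorem eq_of_rowSub_eq {m N : ℕ} {X Y : Matrix (Fin m) (Fin N) ℂ} (J : Finset (Fin m))
    (hX : ∀ i, X i ≠ 0 → i ∈ J) (hY : ∀ i, Y i ≠ 0 → i ∈ J)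
    (h : rowSub X J rfl = rowSub Y J rfl) : X = Y := by
  funext i
  by_cases hi : i ∈ J
  · have := congrFun h ((J.orderIsoOfFin rfl).symm ⟨i, hi⟩)
    change X ↑(J.orderIsoOfFin rfl _) = Y ↑(J.orderIsoOfFin rfl _) at this
    rwa [OrderIso.apply_symm_apply] at this
  · rw [by_contra fun h => hi (hX i h), by_contra fun h => hi (hY i h)]

/-- If all entries of `λ₀` are nonzero, `X₀` has row support of size at most `s`, every row of
`A·X₀` is nonzero, and for every `J ⊇ supp(X₀)` with `|J| ≤ 2s` the matrix
`M(A^{(:,J)}, X₀^{(J,:)})` has full column rank `|J|·N`, then `(λ₀, X₀)` is identifiable up to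
scaling over jointly `s`-sparse matrices. -/
theorem stmt14 {n m N s : ℕ} (hs : 1 ≤ s) (hN : 2 ≤ N)
    (lam0 : Fin n → ℂ) (hlam0 : ∀ k, lam0 k ≠ 0)
    (A : Matrix (Fin n) (Fin m) ℂ) (X0 : Matrix (Fin m) (Fin N) ℂ)
    (hsupp : JointSparse s X0)
    (hrows : ∀ k : Fin n, (A * X0) k ≠ 0)
    (hrank : ∀ J : Finset (Fin m), (∀ i : Fin m, X0 i ≠ 0 → i ∈ J) → J.card ≤ 2 * s →
      (Mmat (colSub A J rfl) (rowSub X0 J rfl)).rank = J.card * N) :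
    ∀ (lam1 : Fin n → ℂ) (X1 : Matrix (Fin m) (Fin N) ℂ), JointSparse s X1 →
      Matrix.diagonal lam1 * A * X1 = Matrix.diagonal lam0 * A * X0 →
      ∃ σ : ℂ, σ ≠ 0 ∧ lam1 = σ⁻¹ • lam0 ∧ X1 = σ • X0 := by
  classical
  intro lam1 X1 hX1 heq
  have hentry : ∀ k c, lam1 k * (A * X1) k c = lam0 k * (A * X0) k c := fun k c => by
    have := congrFun (congrFun heq k) c
    rwa [Matrix.mul_assoc, Matrix.mul_assoc, Matrix.diagonal_mul, Matrix.diagonal_mul] at this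
  set J : Finset (Fin m) := (Finset.univ.filter fun i => X0 i ≠ 0) ∪
    (Finset.univ.filter fun i => X1 i ≠ 0) with hJdef
  have hJ0 : ∀ i, X0 i ≠ 0 → i ∈ J := fun i hi => by simp [hJdef, hi]
  have hJ1 : ∀ i, X1 i ≠ 0 → i ∈ J := fun i hi => by simp [hJdef, hi]
  have hcard : J.card ≤ 2 * s := by
    have h0 : Finset.card {i | X0 i ≠ 0} ≤ s := by
      simpa [JointSparse, Set.ncard_eq_toFinset_card'] using hsupp
    have h1 : Finset.card {i | X1 i ≠ 0} ≤ s := by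
      simpa [JointSparse, Set.ncard_eq_toFinset_card'] using hX1
    exact (Finset.card_union_le _ _).trans ((add_le_add h0 h1).trans_eq (two_mul s).symm)
  have hr := hrank J hJ0 hcard
  rcases Nat.eq_zero_or_pos n with rfl | hn
  · have hle := (Mmat (colSub A J rfl) (rowSub X0 J rfl)).rank_le_card_height
    have hJ : J = ∅ := by
      rw [hr] at hle
      simp only [Fintype.card_sum, Fintype.card_prod, Fintype.card_fin, Fintype.card_unit,
        zero_mul, add_zero] at hle
      rw [← Finset.card_eq_zero]
      by_contra hne
      nlinarith [Nat.pos_of_ne_zero hne]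
    have hz : X1 = X0 := eq_of_rowSub_eq J hJ1 hJ0 <| funext fun i => by
      exact absurd i.isLt (by simp [hJ])
    exact ⟨1, one_ne_zero, Subsingleton.elim _ _, by rw [one_smul, hz]⟩
  have hne : ∀ k, ∃ c, (A * X0) k c ≠ 0 := fun k => Function.ne_iff.mp (hrows k)
  have hlam1 : ∀ k, lam1 k ≠ 0 := fun k h => by
    obtain ⟨c, hc⟩ := hne k
    have := hentry k c
    rw [h, zero_mul] at this
    exact mul_ne_zero (hlam0 k) hc this.symm
  have hpar : ∀ k c d, (A * X0) k c * (A * X1) k d = (A * X0) k d * (A * X1) k c :=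
    fun k c d => mul_left_cancel₀ (hlam1 k) <| by
      linear_combination (A * X0) k c * hentry k d - (A * X0) k d * hentry k c
  have hX0 : rowSub X0 J rfl ≠ 0 := fun h => by
    obtain ⟨c, hc⟩ := hne ⟨0, hn⟩
    rw [← colSub_mul_rowSub A X0 J hJ0, h, Matrix.mul_zero] at hc
    exact hc rfl
  obtain ⟨σ, hσ⟩ := eq_smul_of_Mmat_injective (colSub A J rfl) (rowSub X0 J rfl)
    (rowSub X1 J rfl) hX0
    (mulVec_injective_of_rank_eq_card _ <| by simp [hr, mul_comm])
    (by rwa [colSub_mul_rowSub A X0 J hJ0, colSub_mul_rowSub A X1 J hJ1])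
  have hX : X1 = σ • X0 := eq_of_rowSub_eq J hJ1
    (fun i hi => hJ0 i fun h => hi (by ext c; simp [h])) hσ
  have hmul : ∀ k, lam1 k * σ = lam0 k := fun k => by
    obtain ⟨c, hc⟩ := hne k
    have := hentry k c
    rw [hX, Matrix.mul_smul, Matrix.smul_apply, smul_eq_mul, ← mul_assoc] at this
    exact mul_right_cancel₀ hc this
  have hσ0 : σ ≠ 0 := fun h => hlam0 ⟨0, hn⟩ (by rw [← hmul, h, mul_zero])
  refine ⟨σ, hσ0, funext fun k => ?_, hX⟩
  rw [Pi.smul_apply, smul_eq_mul, ← hmul k, mul_comm (lam1 k), inv_mul_cancel_left₀ hσ0]
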